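/- arXiv:2012.06105 — 2 statements merged into one kernel-verified Lean document; each statement's English description precedes it below -/
import Mathlib

section
/- Let m and k be positive integers with k odd and gcd(m,k) = 1, and let f(x) = x^{(3^k+1)/2} on F_{3^m}. Let C_f ⊆ F_3^{3^m+1} be the subfield code with codewords ((Tr(a f(x)+bx)+c)_{x∈F_{3^m}}, Tr(a)) for a,b ∈ F_{3^m}, c ∈ F_3, and let A_4^⊥ be the number of vectors of Hamming weight 4 in the dual code C_f^⊥. Then A_4^⊥ = 4·3^{m−1} if m is even, and A_4^⊥ = 2·3^{m−1} if m is odd. -/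
noncomputable section
open scoped Classical

instance : Fact (Nat.Prime 3) := ⟨Nat.prime_three⟩

noncomputable instance (p n : ℕ) [Fact p.Prime] : Fintype (GaloisField p n) :=
  Fintype.ofFinite _

/-- The absolute trace map from `F_{3^m}` to `F_3`. -/
def tr (m : ℕ) (x : GaloisField 3 m) : ZMod 3 :=
  Algebra.trace (ZMod 3) (GaloisField 3 m) x

/-- The Coulter–Matthews function `f(x) = x^{(3^k+1)/2}` on `F_{3^m}`. -/
def cmf (m k : ℕ) (x : GaloisField 3 m) : GaloisField 3 m :=
  x ^ ((3 ^ k + 1) / 2)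

/-- The codeword `((Tr(a f(x)+bx)+c)_{x∈F_{3^m}}, Tr(a))` of length `3^m + 1`. -/
def fullWord (m k : ℕ) (a b : GaloisField 3 m) (c : ZMod 3) :
    Option (GaloisField 3 m) → ZMod 3 :=
  fun i => i.elim (tr m a) fun x => tr m (a * cmf m k x + b * x) + c

/-- The dual code `C_f^⊥`: all vectors orthogonal to every codeword of `C_f`. -/
def fullDual (m k : ℕ) : Set (Option (GaloisField 3 m) → ZMod 3) :=
  {v | ∀ (a b : GaloisField 3 m) (c : ZMod 3), ∑ i, v i * fullWord m k a b c i = 0}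

/-- `A_i^⊥`: the number of vectors of Hamming weight `i` in `C_f^⊥`. -/
def dualA (m k i : ℕ) : ℕ :=
  Nat.card {v : Option (GaloisField 3 m) → ZMod 3 //
    v ∈ fullDual m k ∧ hammingNorm v = i}


set_option maxHeartbeats 400000
set_option linter.unusedSimpArgs false

lemma cm_three {K : Type*} [Field K] [CharP K 3] : (3 : K) = 0 := by
  exact_mod_cast CharP.cast_eq_zero K 3

lemma cm_param {K : Type*} [Field K] [CharP K 3] [IsAlgClosed K] (a b c : K)
    (h : a ^ 2 + b ^ 2 + c ^ 2 = 0) :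
    ∃ s t : K, a = s ^ 2 + s * t - t ^ 2 ∧ b = s ^ 2 - s * t - t ^ 2 ∧ c = s ^ 2 + t ^ 2 := by
  have h3 : (3 : K) = 0 := cm_three
  have key : ∃ s t : K, s ^ 2 = a + b - c ∧ t ^ 2 = -(a + b + c) ∧ s * t = b - a := by
    obtain ⟨s, hs⟩ := IsAlgClosed.exists_pow_nat_eq (a + b - c) (n := 2) (by norm_num)
    by_cases h0 : s = 0
    · obtain ⟨t, ht⟩ := IsAlgClosed.exists_pow_nat_eq (-(a + b + c)) (n := 2) (by norm_num)
      refine ⟨s, t, hs, ht, ?_⟩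
      rw [h0, zero_mul]
      rw [h0] at hs
      have : (b - a) ^ 2 = 0 := by
        linear_combination (a + b + c) * hs + 2 * h - c ^ 2 * h3 + 0 * h3
      exact (pow_eq_zero_iff (by norm_num)).1 this |>.symm
    · refine ⟨s, (b - a) / s, hs, ?_, by field_simp⟩
      rw [div_pow, hs, div_eq_iff (by rw [← hs]; exact pow_ne_zero _ h0)]
      linear_combination 2 * h - c ^ 2 * h3
  obtain ⟨s, t, h1, h2, h4⟩ := key
  refine ⟨s, t, ?_, ?_, ?_⟩
  · linear_combination -h1 + h2 - h4 - b * h3 + 0 * h3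
  · linear_combination -h1 + h2 + h4 - a * h3
  · linear_combination -h1 - h2 + c * h3

lemma cm_pow_add {K : Type*} [Field K] [CharP K 3] (j : ℕ) (x y : K) :
    (x + y) ^ 3 ^ j = x ^ 3 ^ j + y ^ 3 ^ j := by
  have : Fact (Nat.Prime 3) := ⟨Nat.prime_three⟩
  exact add_pow_char_pow x y 3 j
lemma cm_pow_sub {K : Type*} [Field K] [CharP K 3] (j : ℕ) (x y : K) :
    (x - y) ^ 3 ^ j = x ^ 3 ^ j - y ^ 3 ^ j := by
  have : Fact (Nat.Prime 3) := ⟨Nat.prime_three⟩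
  exact sub_pow_char_pow x y j

lemma cm_form {K : Type*} [Field K] [CharP K 3] (k : ℕ) (s t : K) :
    (s ^ 2 + s * t - t ^ 2) ^ (3 ^ k + 1) + (s ^ 2 - s * t - t ^ 2) ^ (3 ^ k + 1)
      + (s ^ 2 + t ^ 2) ^ (3 ^ k + 1) = -(s * t ^ 3 ^ k - s ^ 3 ^ k * t) ^ 2 := by
  have h3 : (3 : K) = 0 := cm_three
  simp only [pow_succ _ (3 ^ k), cm_pow_add, cm_pow_sub, mul_pow, ← pow_mul, mul_comm 2 (3 ^ k)]
  simp only [pow_mul]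
  generalize s ^ 3 ^ k = s'
  generalize t ^ 3 ^ k = t'
  linear_combination (s ^ 2 * s' ^ 2 + t ^ 2 * t' ^ 2) * h3

lemma cm_half_odd {k : ℕ} (hk : Odd k) : ∃ n, Odd n ∧ 3 ^ k = 2 * n + 1 := by
  obtain ⟨j, rfl⟩ := hk
  induction j with
  | zero => exact ⟨1, odd_one, by norm_num⟩
  | succ j ih =>
    obtain ⟨n, ⟨l, hl⟩, hn⟩ := ih
    refine ⟨9 * n + 4, ⟨9 * l + 6, by omega⟩, ?_⟩
    rw [show 2 * (j + 1) + 1 = 2 * j + 1 + 2 by ring, pow_add, hn]; ring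

/-- joint sign determination -/
lemma cm_sign {K : Type*} [Field K] (s t s1 t1 : K) (h1 : s ^ 2 = s1 ^ 2) (h2 : s * t = s1 * t1)
    (h3 : t ^ 2 = t1 ^ 2) : (s = s1 ∧ t = t1) ∨ (s = -s1 ∧ t = -t1) := by
  by_cases h0 : s1 = 0
  · have hs : s = 0 := by simpa [h0] using h1
    rcases sq_eq_sq_iff_eq_or_eq_neg.1 h3 with h | h
    · left; simp [*]
    · right; simp [*]
  · rcases sq_eq_sq_iff_eq_or_eq_neg.1 h1 with h | h
    · left; refine ⟨h, ?_⟩; rw [h] at h2; exact mul_left_cancel₀ h0 h2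
    · right; refine ⟨h, ?_⟩; rw [h] at h2; apply mul_left_cancel₀ h0; linear_combination -h2

lemma cm_w_eq {K : Type*} [Field K] [CharP K 3] (k : ℕ) (u v s1 t1 c : K)
    (hA : u ^ 2 = s1 ^ 2) (hP : u * v = s1 * t1) (hC : v ^ 2 = t1 ^ 2)
    (hc : s1 * t1 ^ 3 ^ k - s1 ^ 3 ^ k * t1 = c) :
    u * v ^ 3 ^ k - u ^ 3 ^ k * v = c := by
  have hodd : Odd (3 ^ k) := Odd.pow (by decide)
  rw [← hc]
  rcases cm_sign u v s1 t1 hA hP hC with ⟨rfl, rfl⟩ | ⟨rfl, rfl⟩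
  · rfl
  · rw [hodd.neg_pow, hodd.neg_pow]; ring

lemma cm_w_inv {K : Type*} [Field K] [CharP K 3] [IsAlgClosed K] {k : ℕ} (hk : Odd k)
    (s t u v : K)
    (h1 : u ^ 2 + u * v - v ^ 2 = s ^ 2 + s * t - t ^ 2 ∨
      u ^ 2 + u * v - v ^ 2 = -(s ^ 2 + s * t - t ^ 2))
    (h2 : u ^ 2 - u * v - v ^ 2 = s ^ 2 - s * t - t ^ 2 ∨
      u ^ 2 - u * v - v ^ 2 = -(s ^ 2 - s * t - t ^ 2))
    (h3 : u ^ 2 + v ^ 2 = s ^ 2 + t ^ 2 ∨ u ^ 2 + v ^ 2 = -(s ^ 2 + t ^ 2)) :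
    u * v ^ 3 ^ k - u ^ 3 ^ k * v = s * t ^ 3 ^ k - s ^ 3 ^ k * t := by
  have h30 : (3 : K) = 0 := cm_three
  obtain ⟨n, hn, hq⟩ := cm_half_odd hk
  obtain ⟨i, hi⟩ := IsAlgClosed.exists_pow_nat_eq (-1 : K) (n := 2) (by norm_num)
  have hiq : i ^ 3 ^ k = -i := by
    rw [hq, pow_succ, pow_mul, hi, hn.neg_one_pow]; ring
  have hodd : Odd (3 ^ k) := Odd.pow (by decide)
  have fin : ∀ s1 t1 : K, u ^ 2 + u * v - v ^ 2 = s1 ^ 2 + s1 * t1 - t1 ^ 2 →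
      u ^ 2 - u * v - v ^ 2 = s1 ^ 2 - s1 * t1 - t1 ^ 2 → u ^ 2 + v ^ 2 = s1 ^ 2 + t1 ^ 2 →
      s1 * t1 ^ 3 ^ k - s1 ^ 3 ^ k * t1 = s * t ^ 3 ^ k - s ^ 3 ^ k * t →
      u * v ^ 3 ^ k - u ^ 3 ^ k * v = s * t ^ 3 ^ k - s ^ 3 ^ k * t := by
    intro s1 t1 e1 e2 e3 e4
    refine cm_w_eq k u v s1 t1 _ ?_ ?_ ?_ e4
    · linear_combination e1 + e2 - e3 - (u ^ 2 - v ^ 2 - s1 ^ 2 + t1 ^ 2) * h30 + (u^2 - s1^2 -v^2 + t1^2) * h30 - (-v^2*1 + t1^2) * h30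
    · linear_combination -e1 + e2 + (u * v - s1 * t1) * h30
    · linear_combination -e1 - e2 - e3 + (u ^ 2 - s1 ^ 2) * h30
  rcases h1 with h1 | h1 <;> rcases h2 with h2 | h2 <;> rcases h3 with h3 | h3
  · exact fin s t h1 h2 h3 rfl
  · refine fin (i * t) (-(i * s)) ?_ ?_ ?_ ?_
    · clear fin; grind
    · clear fin; grind
    · clear fin; grind
    · simp only [mul_pow, hodd.neg_pow, cm_pow_add, cm_pow_sub, hiq]
      generalize s ^ 3 ^ k = s'
      generalize t ^ 3 ^ k = t'
      clear fin h1 h2 h3; grind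
  · refine fin (i * (s - t)) (-(i * (s + t))) ?_ ?_ ?_ ?_
    · clear fin; grind
    · clear fin; grind
    · clear fin; grind
    · simp only [mul_pow, hodd.neg_pow, cm_pow_add, cm_pow_sub, hiq]
      generalize s ^ 3 ^ k = s'
      generalize t ^ 3 ^ k = t'
      clear fin h1 h2 h3; grind
  · refine fin (s + t) (s - t) ?_ ?_ ?_ ?_
    · clear fin; grind
    · clear fin; grind
    · clear fin; grind
    · simp only [mul_pow, hodd.neg_pow, cm_pow_add, cm_pow_sub, hiq]
      generalize s ^ 3 ^ k = s'
      generalize t ^ 3 ^ k = t'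
      clear fin h1 h2 h3; grind
  · refine fin (i * (s + t)) (i * (s - t)) ?_ ?_ ?_ ?_
    · clear fin; grind
    · clear fin; grind
    · clear fin; grind
    · simp only [mul_pow, hodd.neg_pow, cm_pow_add, cm_pow_sub, hiq]
      generalize s ^ 3 ^ k = s'
      generalize t ^ 3 ^ k = t'
      clear fin h1 h2 h3; grind
  · refine fin (s - t) (-(s + t)) ?_ ?_ ?_ ?_
    · clear fin; grind
    · clear fin; grind
    · clear fin; grind
    · simp only [mul_pow, hodd.neg_pow, cm_pow_add, cm_pow_sub, hiq]
      generalize s ^ 3 ^ k = s'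
      generalize t ^ 3 ^ k = t'
      clear fin h1 h2 h3; grind
  · refine fin (t) (-s) ?_ ?_ ?_ ?_
    · clear fin; grind
    · clear fin; grind
    · clear fin; grind
    · simp only [mul_pow, hodd.neg_pow, cm_pow_add, cm_pow_sub, hiq]
      generalize s ^ 3 ^ k = s'
      generalize t ^ 3 ^ k = t'
      clear fin h1 h2 h3; grind
  · refine fin (i * s) (i * t) ?_ ?_ ?_ ?_
    · clear fin; grind
    · clear fin; grind
    · clear fin; grind
    · simp only [mul_pow, hodd.neg_pow, cm_pow_add, cm_pow_sub, hiq]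
      generalize s ^ 3 ^ k = s'
      generalize t ^ 3 ^ k = t'
      clear fin h1 h2 h3; grind
set_option maxHeartbeats 400000

lemma cm_ext.{u} (F : Type u) [Field F] [CharP F 3] : ∃ (K : Type u) (_ : Field K)
    (_ : IsAlgClosed K) (_ : CharP K 3), Nonempty (F →+* K) :=
  ⟨AlgebraicClosure F, inferInstance, inferInstance,
    charP_of_injective_algebraMap (algebraMap F _).injective 3, ⟨algebraMap F _⟩⟩

lemma cm_fix {F : Type*} [Field F] [Fintype F] {m k : ℕ} (hF : Fintype.card F = 3 ^ m)
    (hmk : Nat.gcd m k = 1) (x : F) (hx : x ^ 3 ^ k = x) : x = 0 ∨ x = 1 ∨ x = -1 := by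
  by_cases h0 : x = 0
  · exact Or.inl h0
  right
  have h1 : x ^ (3 ^ m - 1) = 1 := by rw [← hF]; exact FiniteField.pow_card_sub_one_eq_one x h0
  have h2 : x ^ (3 ^ k - 1) = 1 := by
    apply mul_right_cancel₀ h0
    rw [← pow_succ, Nat.sub_add_cancel (Nat.one_le_pow _ _ (by norm_num)), hx, one_mul]
  have h3 : orderOf x ∣ Nat.gcd (3 ^ m - 1) (3 ^ k - 1) :=
    Nat.dvd_gcd (orderOf_dvd_of_pow_eq_one h1) (orderOf_dvd_of_pow_eq_one h2)
  rw [Nat.pow_sub_one_gcd_pow_sub_one, hmk] at h3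
  have h4 : x ^ 2 = 1 := orderOf_dvd_iff_pow_eq_one.1 (by simpa using h3)
  exact sq_eq_sq_iff_eq_or_eq_neg.1 (by rw [h4, one_pow]) 

/-- the exponent is twice an odd number -/
lemma cm_e {k : ℕ} (hk : Odd k) : ∃ e', Odd e' ∧ (3 ^ k + 1) / 2 = 2 * e' ∧ 3 ^ k + 1 = 4 * e' := by
  obtain ⟨j, rfl⟩ := hk
  have : ∃ l, 3 ^ (2 * j + 1) = 8 * l + 3 := by
    induction j with
    | zero => exact ⟨0, by norm_num⟩
    | succ j ih =>
      obtain ⟨l, hl⟩ := ih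
      exact ⟨9 * l + 3, by rw [show 2 * (j + 1) + 1 = 2 * j + 1 + 2 by ring, pow_add, hl]; ring⟩
  obtain ⟨l, hl⟩ := this
  rw [hl]
  exact ⟨2 * l + 1, ⟨l, rfl⟩, by omega, by omega⟩

lemma cm_gcd_e {m k e' : ℕ} (hmk : Nat.gcd m k = 1) (ho : Odd e') (he : 3 ^ k + 1 = 4 * e') :
    Nat.Coprime e' (3 ^ m - 1) := by
  have h1 : e' ∣ 3 ^ (2 * k) - 1 := by
    have : 3 ^ (2 * k) - 1 = (3 ^ k + 1) * (3 ^ k - 1) := by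
      rw [mul_comm 2 k, pow_mul, ← Nat.sq_sub_sq]
    rw [this, he]
    exact ⟨4 * (3 ^ k - 1), by ring⟩
  have h2 : Nat.gcd e' (3 ^ m - 1) ∣ 3 ^ Nat.gcd (2 * k) m - 1 := by
    rw [← Nat.pow_sub_one_gcd_pow_sub_one]
    exact Nat.gcd_dvd_gcd_of_dvd_left _ h1
  have h3 : Nat.gcd (2 * k) m ∣ 2 := by
    have : Nat.Coprime (Nat.gcd (2 * k) m) k :=
      Nat.Coprime.coprime_dvd_left (Nat.gcd_dvd_right _ _) hmk
    exact this.dvd_of_dvd_mul_right (Nat.gcd_dvd_left _ _)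
  have h4 : Nat.gcd e' (3 ^ m - 1) ∣ 8 := by
    rcases (Nat.dvd_prime Nat.prime_two).1 h3 with h | h <;> rw [h] at h2
    · exact h2.trans (by norm_num)
    · exact h2.trans (by norm_num)
  have h5 : Nat.Coprime (Nat.gcd e' (3 ^ m - 1)) (2 ^ 3) := by
    apply Nat.Coprime.pow_right
    exact Nat.Coprime.coprime_dvd_left (Nat.gcd_dvd_left _ _) (Nat.coprime_two_right.2 ho)
  exact Nat.Coprime.eq_one_of_dvd h5 h4

lemma cm_gcd_n {m k n : ℕ} (hk : Odd k) (hmk : Nat.gcd m k = 1) (ho : Odd n)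
    (hn : 3 ^ k = 2 * n + 1) : Nat.Coprime n (3 ^ (2 * m) - 1) := by
  have h2 : Nat.gcd n (3 ^ (2 * m) - 1) ∣ 3 ^ Nat.gcd k (2 * m) - 1 := by
    rw [← Nat.pow_sub_one_gcd_pow_sub_one]
    exact Nat.gcd_dvd_gcd_of_dvd_left _ ⟨2, by omega⟩
  have h3 : Nat.gcd k (2 * m) = 1 :=
    Nat.Coprime.mul_right (Nat.coprime_two_right.2 hk) (Nat.Coprime.symm hmk)
  rw [h3] at h2
  have h5 : Nat.Coprime (Nat.gcd n (3 ^ (2 * m) - 1)) 2 := 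
    Nat.Coprime.coprime_dvd_left (Nat.gcd_dvd_left _ _) (Nat.coprime_two_right.2 ho)
  exact Nat.Coprime.eq_one_of_dvd h5 (by simpa using h2)

/-- coprime powers are injective on elements of exponent `N`. -/
lemma cm_pow_inj {K : Type*} [Field K] {n N : ℕ} (h : Nat.Coprime n N) (a b : K) (ha : a ≠ 0)
    (hb : b ≠ 0) (haN : a ^ N = 1) (hbN : b ^ N = 1) (hab : a ^ n = b ^ n) : a = b := by
  have h1 : (a / b) ^ n = 1 := by rw [div_pow, hab, div_self (pow_ne_zero _ hb)]
  have h2 : (a / b) ^ N = 1 := by rw [div_pow, haN, hbN, div_one]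
  have h3 : orderOf (a / b) ∣ Nat.gcd n N :=
    Nat.dvd_gcd (orderOf_dvd_of_pow_eq_one h1) (orderOf_dvd_of_pow_eq_one h2)
  rw [h, Nat.dvd_one, orderOf_eq_one_iff] at h3
  exact (div_eq_one_iff_eq hb).1 h3

lemma cm_card_roots {F : Type*} [Field F] [Fintype F] [DecidableEq F] [CharP F 3] {m k : ℕ}
    (hF : Fintype.card F = 3 ^ m) (hk : Odd k)
    (hmk : Nat.gcd m k = 1) (c : F) (hc : c ≠ 0) :
    (Finset.univ.filter fun d : F => d ^ ((3 ^ k + 1) / 2) = c ^ 2).card = 2 := by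
  obtain ⟨e', ho, he, he4⟩ := cm_e hk
  have hcop := cm_gcd_e (m := m) hmk ho he4
  have he0 : e' ≠ 0 := by rintro rfl; simp at ho
  have hinj : ∀ a b : F, a ≠ 0 → b ≠ 0 → a ^ e' = b ^ e' → a = b := by
    intro a b ha hb hab
    refine cm_pow_inj hcop a b ha hb ?_ ?_ hab
    · rw [← hF]; exact FiniteField.pow_card_sub_one_eq_one a ha
    · rw [← hF]; exact FiniteField.pow_card_sub_one_eq_one b hb
  have hinj' : Function.Injective fun a : F => a ^ e' := by
    intro a b hab
    simp only at hab
    by_cases ha : a = 0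
    · subst ha
      rw [zero_pow he0] at hab
      exact ((pow_eq_zero_iff he0).1 hab.symm).symm
    · by_cases hb : b = 0
      · subst hb
        rw [zero_pow he0] at hab
        exact (pow_eq_zero_iff he0).1 hab
      · exact hinj a b ha hb hab
  obtain ⟨v, hv⟩ := (Finite.injective_iff_surjective.1 hinj') c
  simp only at hv
  have hv0 : v ≠ 0 := by rintro rfl; rw [zero_pow he0] at hv; exact hc hv.symm
  have : (Finset.univ.filter fun d : F => d ^ ((3 ^ k + 1) / 2) = c ^ 2) = {v, -v} := by
    ext d
    simp only [Finset.mem_filter, Finset.mem_univ, true_and, Finset.mem_insert,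
      Finset.mem_singleton]
    rw [he, ← hv, pow_mul, ← pow_mul v, mul_comm e' 2, pow_mul]
    rw [← sq_eq_sq_iff_eq_or_eq_neg]
    exact ⟨fun h => hinj' h, fun h => by rw [h]⟩
  rw [this, Finset.card_pair]
  intro h
  have h3 : (3 : F) = 0 := cm_three
  apply hv0
  linear_combination v * h3 - h

/-- `g(x) = f(x) + f(x+1) + f(x-1)` is minus a nonzero square. -/
lemma cm_g {F : Type*} [Field F] [Fintype F] [CharP F 3] {m k : ℕ}
    (hF : Fintype.card F = 3 ^ m) (hk : Odd k) (hmk : Nat.gcd m k = 1) (x : F) :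
    ∃ c : F, c ≠ 0 ∧ x ^ ((3 ^ k + 1) / 2) + (x + 1) ^ ((3 ^ k + 1) / 2)
      + (x - 1) ^ ((3 ^ k + 1) / 2) = -c ^ 2 := by
  obtain ⟨e', ho, he, he4⟩ := cm_e hk
  set e := (3 ^ k + 1) / 2 with hedef
  have he2 : 3 ^ k + 1 = 2 * e := by omega
  set g := x ^ e + (x + 1) ^ e + (x - 1) ^ e with hg
  obtain ⟨K, _, _, _, ⟨φ⟩⟩ := cm_ext F
  have h3 : (3 : K) = 0 := cm_three
  obtain ⟨α, hα⟩ := IsAlgClosed.exists_pow_nat_eq (φ x) (n := 2) (by norm_num)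
  obtain ⟨β, hβ⟩ := IsAlgClosed.exists_pow_nat_eq (φ (x + 1)) (n := 2) (by norm_num)
  obtain ⟨γ, hγ⟩ := IsAlgClosed.exists_pow_nat_eq (φ (x - 1)) (n := 2) (by norm_num)
  have hsum : α ^ 2 + β ^ 2 + γ ^ 2 = 0 := by
    rw [hα, hβ, hγ, map_add, map_sub, map_one]
    linear_combination φ x * h3
  obtain ⟨s, t, ea, eb, ec⟩ := cm_param α β γ hsum
  set w := s * t ^ 3 ^ k - s ^ 3 ^ k * t with hw
  have hgw : φ g = -w ^ 2 := by
    rw [hw, ← cm_form, ← ea, ← eb, ← ec, he2, hg]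
    simp only [pow_mul, hα, hβ, hγ, map_add φ (_ + _), map_add φ (x ^ e), map_pow]
  have hx3 : ∀ y : F, y ^ 3 ^ m = y := fun y => by rw [← hF]; exact FiniteField.pow_card y
  -- nonvanishing
  have hw0 : w ≠ 0 := by
    intro h0
    have hxx : x ^ 3 ^ k = x := by
      have hl : ∃ l : K, s ^ 3 ^ k = l * s ∧ t ^ 3 ^ k = l * t := by
        have hne : (3 ^ k) ≠ 0 := by positivity
        by_cases hs : s = 0
        · by_cases ht : t = 0
          · exact ⟨0, by simp [hs, hne], by simp [ht, hne]⟩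
          · exact ⟨t ^ 3 ^ k / t, by simp [hs, hne], by field_simp⟩
        · refine ⟨s ^ 3 ^ k / s, by field_simp, ?_⟩
          field_simp
          linear_combination h0
      obtain ⟨l, hs, ht⟩ := hl
      have ha : α ^ 3 ^ k = l ^ 2 * α := by
        rw [ea]
        simp only [cm_pow_add, cm_pow_sub, mul_pow, pow_right_comm _ 2, hs, ht]; ring
      have hb : β ^ 3 ^ k = l ^ 2 * β := by
        rw [eb]
        simp only [cm_pow_sub, mul_pow, pow_right_comm _ 2, hs, ht]; ring
      have hxa : φ x ^ 3 ^ k = l ^ 4 * φ x := by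
        rw [← hα, pow_right_comm, ha]; ring
      have hxb : (φ x + 1) ^ 3 ^ k = l ^ 4 * (φ x + 1) := by
        rw [← map_one φ, ← map_add, ← hβ, pow_right_comm, hb]; ring
      rw [cm_pow_add, one_pow] at hxb
      have hl4 : l ^ 4 = 1 := by linear_combination hxa - hxb
      apply φ.injective
      rw [map_pow, hxa, hl4, one_mul]
    have h30 : (3 : F) = 0 := cm_three
    have hg0 : g = 0 := by
      apply φ.injective
      rw [hgw, h0, map_zero]; ring
    have heven : Even e := ⟨e', by omega⟩
    have hene : e ≠ 0 := by rintro h; rw [h] at he2; simp at he2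
    have h2 : (2 : F) ≠ 0 := by
      intro h; exact one_ne_zero (α := F) (by linear_combination h30 - h)
    rcases cm_fix hF hmk x hxx with h | h | h
    · rw [hg, h] at hg0
      simp [heven.neg_pow, hene] at hg0
      exact h2 (by linear_combination hg0)
    · rw [hg, h, show (1 + 1 : F) = -1 by linear_combination h30] at hg0
      simp [heven.neg_pow, hene] at hg0
      exact h2 (by linear_combination hg0)
    · rw [hg, h, show (-1 - 1 : F) = 1 by linear_combination -h30] at hg0
      simp [heven.neg_pow, hene] at hg0
      exact h2 (by linear_combination hg0)
  -- rationality
  have hwQ : w ^ 3 ^ m = w := by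
    have : w ^ 3 ^ m = (s ^ 3 ^ m) * (t ^ 3 ^ m) ^ 3 ^ k - (s ^ 3 ^ m) ^ 3 ^ k * t ^ 3 ^ m := by
      rw [hw, cm_pow_sub, mul_pow, mul_pow, pow_right_comm t, pow_right_comm s]
    rw [this]
    have hroot : ∀ (y : F) (a : K), a ^ 2 = φ y → a ^ 3 ^ m = a ∨ a ^ 3 ^ m = -a := by
      intro y a hy
      apply sq_eq_sq_iff_eq_or_eq_neg.1
      rw [pow_right_comm, hy, ← map_pow, hx3]
    have H1 := hroot _ _ hα
    have H2 := hroot _ _ hβ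
    have H3 := hroot _ _ hγ
    rw [ea] at H1
    rw [eb] at H2
    rw [ec] at H3
    simp only [cm_pow_sub, cm_pow_add, mul_pow, pow_right_comm _ 2] at H1 H2 H3
    exact cm_w_inv hk s t _ _ H1 H2 H3
  have hsq : IsSquare (-g) := by
    have hg0 : -g ≠ 0 := by
      intro h
      apply hw0
      have : φ g = 0 := by rw [neg_eq_zero.1 h, map_zero]
      rw [hgw] at this
      simpa using this
    have hchar : ringChar F ≠ 2 := by rw [ringChar.eq F 3]; norm_num
    rw [FiniteField.isSquare_iff hchar hg0]
    apply φ.injective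
    rw [map_pow, map_neg, hgw, neg_neg, ← pow_mul, map_one, hF]
    have hodd : Odd (3 ^ m) := Odd.pow (by decide)
    apply mul_right_cancel₀ hw0
    rw [← pow_succ, show 2 * (3 ^ m / 2) + 1 = 3 ^ m by
      obtain ⟨r, hr⟩ := hodd; omega, hwQ, one_mul]
  obtain ⟨c, hc⟩ := hsq
  refine ⟨c, ?_, by linear_combination -hc⟩
  rintro rfl
  apply hw0
  have : φ g = 0 := by rw [neg_eq_zero.1 (hc.trans (mul_zero _)), map_zero]
  rw [hgw] at this
  simpa using this

/-- planarity, normalised -/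
lemma cm_planar1 {F : Type*} [Field F] [Fintype F] [CharP F 3] {m k : ℕ}
    (hF : Fintype.card F = 3 ^ m) (hk : Odd k) (hmk : Nat.gcd m k = 1) (x y : F)
    (h : (x + 1) ^ ((3 ^ k + 1) / 2) - (x - 1) ^ ((3 ^ k + 1) / 2)
       = (y + 1) ^ ((3 ^ k + 1) / 2) - (y - 1) ^ ((3 ^ k + 1) / 2)) : x = y := by
  obtain ⟨e', ho, he, he4⟩ := cm_e hk
  obtain ⟨n, hno, hn⟩ := cm_half_odd hk
  set e := (3 ^ k + 1) / 2 with hedef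
  have he2 : 2 * e = 3 ^ k + 1 := by omega
  obtain ⟨K, _, _, _, ⟨φ⟩⟩ := cm_ext F
  have h3 : (3 : K) = 0 := cm_three
  have hx3 : ∀ y : F, y ^ 3 ^ m = y := fun y => by rw [← hF]; exact FiniteField.pow_card y
  have key : ∀ x : F, ∃ b : K, b ≠ 0 ∧ φ x = b + b⁻¹ ∧ b ^ (3 ^ (2 * m) - 1) = 1 ∧
      φ ((x + 1) ^ e - (x - 1) ^ e) = b ^ n + (b ^ n)⁻¹ := by
    intro x
    obtain ⟨i, hi⟩ := IsAlgClosed.exists_pow_nat_eq (φ x ^ 2 - 1) (n := 2) (by norm_num)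
    obtain ⟨a, hba⟩ := IsAlgClosed.exists_pow_nat_eq (-φ x + i) (n := 2) (by norm_num)
    have hq : a ^ 4 - φ x * a ^ 2 + 1 = 0 := by
      rw [show a ^ 4 = (a ^ 2) ^ 2 by ring, hba]
      linear_combination hi + φ x ^ 2 * h3 - φ x * i * h3
    have ha0 : a ≠ 0 := by rintro rfl; simp at hq
    have hxb : φ x = a ^ 2 + (a ^ 2)⁻¹ := by field_simp; linear_combination -hq
    refine ⟨a ^ 2, pow_ne_zero _ ha0, hxb, ?_, ?_⟩
    · have hQ : (a ^ 2) ^ 3 ^ m = a ^ 2 ∨ (a ^ 2) ^ 3 ^ m = (a ^ 2)⁻¹ := by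
        set b := a ^ 2 with hb
        have hb0 : b ≠ 0 := pow_ne_zero _ ha0
        have : b ^ 3 ^ m + (b ^ 3 ^ m)⁻¹ = b + b⁻¹ := by
          rw [← hxb, ← inv_pow, ← cm_pow_add, ← hxb, ← map_pow, hx3]
        have hc0 : b ^ 3 ^ m ≠ 0 := pow_ne_zero _ hb0
        generalize b ^ 3 ^ m = c at *
        field_simp at this
        have h' : (c - b) * (c * b - 1) = 0 := by linear_combination this
        rcases mul_eq_zero.1 h' with h | h
        · left; linear_combination h
        · right; field_simp; linear_combination h
      have hQ2 : (a ^ 2) ^ 3 ^ (2 * m) = a ^ 2 := by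
        rw [two_mul, pow_add, pow_mul]
        rcases hQ with h | h
        · rw [h, h]
        · rw [h, inv_pow, h, inv_inv]
      apply mul_right_cancel₀ (pow_ne_zero 2 ha0)
      rw [← pow_succ, Nat.sub_add_cancel (Nat.one_le_pow _ _ (by norm_num)), hQ2, one_mul]
    · have e1 : φ (x + 1) = (a - a⁻¹) ^ 2 := by
        rw [map_add, map_one, hxb]; field_simp; linear_combination a ^ 2 * h3
      have e2 : φ (x - 1) = (a + a⁻¹) ^ 2 := by
        rw [map_sub, map_one, hxb]; field_simp; linear_combination -a ^ 2 * h3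
      rw [map_sub, map_pow, map_pow, e1, e2, ← pow_mul, ← pow_mul, he2, pow_succ, pow_succ,
        cm_pow_add, cm_pow_sub, inv_pow]
      have : a ^ 3 ^ k = (a ^ 2) ^ n * a := by rw [hn, pow_succ, pow_mul]
      rw [this]
      have hz : (a ^ 2) ^ n ≠ 0 := pow_ne_zero _ (pow_ne_zero _ ha0)
      generalize (a ^ 2) ^ n = z at *
      field_simp
      linear_combination -(z ^ 2 + 1) * a ^ 2 * h3
  obtain ⟨b, hb0, hxb, hbN, hbf⟩ := key x
  obtain ⟨c, hc0, hyc, hcN, hcf⟩ := key y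
  have hcop := cm_gcd_n (m := m) hk hmk hno hn
  apply φ.injective
  rw [hxb, hyc]
  rw [h, hcf] at hbf
  have hbn : b ^ n ≠ 0 := pow_ne_zero _ hb0
  have hcn : c ^ n ≠ 0 := pow_ne_zero _ hc0
  have : b ^ n = c ^ n ∨ b ^ n = (c⁻¹) ^ n := by
    rw [inv_pow]
    generalize b ^ n = B at *
    generalize c ^ n = C at *
    field_simp at hbf
    have h' : (B - C) * (B * C - 1) = 0 := by linear_combination -hbf
    rcases mul_eq_zero.1 h' with h | h
    · left; linear_combination h
    · right; field_simp; linear_combination h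
  rcases this with h | h
  · rw [cm_pow_inj hcop b c hb0 hc0 hbN hcN h]
  · rw [cm_pow_inj hcop b c⁻¹ hb0 (inv_ne_zero hc0) hbN (by rw [inv_pow, hcN, inv_one]) h, inv_inv,
      add_comm]

lemma cm_planar {F : Type*} [Field F] [Fintype F] [CharP F 3] {m k : ℕ}
    (hF : Fintype.card F = 3 ^ m) (hk : Odd k) (hmk : Nat.gcd m k = 1) (a b c d : F)
    (hac : a ≠ c) (h1 : a + b = c + d)
    (h : a ^ ((3 ^ k + 1) / 2) + b ^ ((3 ^ k + 1) / 2)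
       = c ^ ((3 ^ k + 1) / 2) + d ^ ((3 ^ k + 1) / 2)) : a = d := by
  have h3 : (3 : F) = 0 := cm_three
  set δ := c - a with hδ
  have hd0 : δ ≠ 0 := fun h => hac (by linear_combination -h)
  have := cm_planar1 hF hk hmk ((a - δ) / δ) ((d - δ) / δ) ?_
  · field_simp at this
    linear_combination this
  · have e1 : (a - δ) / δ + 1 = a / δ := by field_simp; ring
    have e2 : (a - δ) / δ - 1 = c / δ := by
      field_simp; rw [hδ]; linear_combination (a - c) * h3
    have e3 : (d - δ) / δ + 1 = d / δ := by field_simp; ring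
    have e4 : (d - δ) / δ - 1 = b / δ := by
      field_simp; rw [hδ]; linear_combination (a - c) * h3 - h1
    rw [e1, e2, e3, e4]
    simp only [div_pow]
    field_simp
    linear_combination h
set_option maxHeartbeats 400000

lemma cm_card_U {F : Type*} [Field F] [Fintype F] [CharP F 3] {m k : ℕ}
    (hF : Fintype.card F = 3 ^ m) (hk : Odd k) (hmk : Nat.gcd m k = 1) :
    (Finset.univ.filter fun p : F × F => p.1 ≠ p.2 ∧
      (p.1 ^ ((3 ^ k + 1) / 2) + p.2 ^ ((3 ^ k + 1) / 2) + (-p.1 - p.2) ^ ((3 ^ k + 1) / 2) = 1 ∨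
       p.1 ^ ((3 ^ k + 1) / 2) + p.2 ^ ((3 ^ k + 1) / 2) + (-p.1 - p.2) ^ ((3 ^ k + 1) / 2) = -1)).card
    = 3 ^ m * (if Even m then 4 else 2) := by
  have h30 : (3 : F) = 0 := cm_three
  obtain ⟨e', ho, he, he4⟩ := cm_e hk
  set e := (3 ^ k + 1) / 2 with hedef
  have hev : Even e := ⟨e', by omega⟩
  have hene : e ≠ 0 := by rintro h; rw [h] at he; rcases ho with ⟨r, hr⟩; omega
  let g : F → F := fun x => x ^ e + (x + 1) ^ e + (x - 1) ^ e
  let V : F → Finset F := fun x => Finset.univ.filter fun d => d ^ e * g x = 1 ∨ d ^ e * g x = -1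
  have hVc : ∀ x, (V x).card = if Even m then 4 else 2 := by
    intro x
    obtain ⟨c, hc0, hc⟩ := cm_g hF hk hmk x
    have hgx : g x = -c ^ 2 := hc
    have hcc : c ^ 2 * (c⁻¹) ^ 2 = 1 := by field_simp
    have hV : V x = (Finset.univ.filter fun d : F => d ^ e = (c⁻¹) ^ 2) ∪
        (Finset.univ.filter fun d : F => d ^ e = -(c⁻¹) ^ 2) := by
      ext d
      simp only [V, Finset.mem_filter, Finset.mem_univ, true_and, Finset.mem_union, hgx]
      rw [or_comm]
      apply or_congr
      · constructor <;> intro h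
        · linear_combination -(c⁻¹) ^ 2 * h - d ^ e * hcc
        · linear_combination -c ^ 2 * h - hcc
      · constructor <;> intro h
        · linear_combination -(c⁻¹) ^ 2 * h - d ^ e * hcc
        · linear_combination -c ^ 2 * h + hcc
    have hdisj : Disjoint (Finset.univ.filter fun d : F => d ^ e = (c⁻¹) ^ 2)
        (Finset.univ.filter fun d : F => d ^ e = -(c⁻¹) ^ 2) := by
      rw [Finset.disjoint_left]
      intro d h1 h2
      simp only [Finset.mem_filter, Finset.mem_univ, true_and] at h1 h2
      have : (c⁻¹) ^ 2 = 0 := by linear_combination (c⁻¹) ^ 2 * h30 - h2 + h1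
      exact (pow_ne_zero 2 (inv_ne_zero hc0)) this
    rw [hV, Finset.card_union_of_disjoint hdisj, cm_card_roots hF hk hmk _ (inv_ne_zero hc0)]
    have hsq : IsSquare (-1 : F) ↔ Even m := by
      rw [FiniteField.isSquare_neg_one_iff, hF]
      rcases Nat.even_or_odd m with h | h
      · obtain ⟨r, rfl⟩ := id h
        simp only [h, iff_true]
        rw [← two_mul, pow_mul, Nat.pow_mod]; norm_num
      · have h' := Nat.not_even_iff_odd.2 h
        obtain ⟨r, rfl⟩ := h
        simp only [h', iff_false, not_not]
        rw [pow_succ, pow_mul, Nat.mul_mod, Nat.pow_mod]; norm_num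
    split_ifs with hm
    · obtain ⟨i, hi⟩ := hsq.2 hm
      have hi0 : i ≠ 0 := by rintro rfl; simp at hi
      have : -(c⁻¹) ^ 2 = (i * c⁻¹) ^ 2 := by linear_combination (c⁻¹) ^ 2 * hi
      rw [this, cm_card_roots hF hk hmk _ (mul_ne_zero hi0 (inv_ne_zero hc0))]
    · have : (Finset.univ.filter fun d : F => d ^ e = -(c⁻¹) ^ 2) = ∅ := by
        rw [Finset.filter_eq_empty_iff]
        intro d _ hd
        apply hm
        apply hsq.1
        refine ⟨d ^ e' * c, ?_⟩
        rw [show d ^ e' * c * (d ^ e' * c) = d ^ (2 * e') * c ^ 2 by ring, ← he, hd]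
        field_simp
      rw [this, Finset.card_empty]
  have hVs : (Finset.univ.sigma V).card = 3 ^ m * (if Even m then 4 else 2) := by
    rw [Finset.card_sigma, Finset.sum_congr rfl (fun x _ => hVc x), Finset.sum_const,
      Finset.card_univ, hF, smul_eq_mul]
  rw [← hVs]
  symm
  have hid : ∀ x d : F, (d * x) ^ e + (d * x + d) ^ e + (-(d * x) - (d * x + d)) ^ e
      = d ^ e * g x := by
    intro x d
    rw [show -(d * x) - (d * x + d) = d * (x - 1) by linear_combination -(d * x) * h30,
      show d * x + d = d * (x + 1) by ring]
    simp only [mul_pow, g]; ring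
  refine Finset.card_bij (fun p _ => (p.2 * p.1, p.2 * p.1 + p.2)) ?_ ?_ ?_
  · rintro ⟨x, d⟩ hp
    simp only [V, Finset.mem_sigma, Finset.mem_filter, Finset.mem_univ, true_and] at hp ⊢
    rw [hid]
    refine ⟨?_, hp⟩
    intro h
    have hd : d = 0 := by linear_combination -h
    rw [hd, zero_pow hene] at hp
    simp at hp
  · rintro ⟨x, d⟩ hp ⟨y, d'⟩ hp' heq
    simp only [V, Finset.mem_sigma, Finset.mem_filter, Finset.mem_univ, true_and] at hp
    simp only [Prod.mk.injEq] at heq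
    obtain ⟨h1, h2⟩ := heq
    have hdd : d = d' := by linear_combination h2 - h1
    subst hdd
    have hd : d ≠ 0 := by
      rintro rfl
      rw [zero_pow hene] at hp
      simp at hp
    have := mul_left_cancel₀ hd h1
    subst this
    rfl
  · rintro ⟨t, t'⟩ hp
    simp only [Finset.mem_filter, Finset.mem_univ, true_and] at hp
    obtain ⟨hne, hp⟩ := hp
    have hd : t' - t ≠ 0 := sub_ne_zero.2 (Ne.symm hne)
    have e1 : (t' - t) * (t / (t' - t)) = t := by field_simp
    refine ⟨⟨t / (t' - t), t' - t⟩, ?_, ?_⟩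
    · simp only [V, Finset.mem_sigma, Finset.mem_filter, Finset.mem_univ, true_and]
      rw [← hid, e1, add_sub_cancel]
      exact hp
    · simp only [e1, add_sub_cancel]

lemma cm_mem_dual (m k : ℕ) (v : Option (GaloisField 3 m) → ZMod 3) :
    v ∈ fullDual m k ↔ (∑ x, v (some x) = 0) ∧
      (∑ x, algebraMap (ZMod 3) (GaloisField 3 m) (v (some x)) * x = 0) ∧
      (∑ x, algebraMap (ZMod 3) (GaloisField 3 m) (v (some x)) * cmf m k x
        + algebraMap (ZMod 3) (GaloisField 3 m) (v none) = 0) := by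
  have htr : ∀ (r : ZMod 3) (y : GaloisField 3 m),
      r * tr m y = tr m (algebraMap (ZMod 3) (GaloisField 3 m) r * y) := by
    intro r y
    unfold tr
    rw [← Algebra.smul_def, map_smul, smul_eq_mul]
  have hadd : ∀ x y, tr m (x + y) = tr m x + tr m y := fun x y => by simp [tr]
  have hsum : ∀ h : GaloisField 3 m → GaloisField 3 m, tr m (∑ x, h x) = ∑ x, tr m (h x) :=
    fun h => by simp [tr]
  have htr0 : tr m 0 = 0 := by simp [tr]
  have key : ∀ a b c, ∑ i, v i * fullWord m k a b c i
      = tr m (a * (∑ x, algebraMap (ZMod 3) (GaloisField 3 m) (v (some x)) * cmf m k x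
        + algebraMap (ZMod 3) (GaloisField 3 m) (v none)))
      + tr m (b * ∑ x, algebraMap (ZMod 3) (GaloisField 3 m) (v (some x)) * x)
      + c * ∑ x, v (some x) := by
    intro a b c
    rw [Fintype.sum_option, mul_add, hadd, Finset.mul_sum, Finset.mul_sum, Finset.mul_sum, hsum,
      hsum]
    simp only [fullWord, Option.elim]
    rw [htr, mul_comm a (algebraMap _ _ _)]
    have : ∀ x, v (some x) * (tr m (a * cmf m k x + b * x) + c)
      = tr m (a * (algebraMap (ZMod 3) (GaloisField 3 m) (v (some x)) * cmf m k x))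
        + tr m (b * (algebraMap (ZMod 3) (GaloisField 3 m) (v (some x)) * x))
        + c * v (some x) := by
      intro x
      rw [mul_add, htr, mul_add, hadd, mul_left_comm, mul_left_comm _ b, mul_comm c]
    simp only [this, Finset.sum_add_distrib]
    ring
  have nondeg : ∀ y : GaloisField 3 m, (∀ a, tr m (a * y) = 0) → y = 0 := by
    intro y hy
    by_contra h0
    have hnd := traceForm_nondegenerate (ZMod 3) (GaloisField 3 m)
    apply h0
    apply hnd.1
    intro a
    rw [Algebra.traceForm_apply, mul_comm]
    exact hy a
  constructor
  · intro hv
    refine ⟨?_, ?_, ?_⟩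
    · have := hv 0 0 1
      rw [key] at this
      simpa [htr0] using this
    · apply nondeg
      intro b
      have := hv 0 b 0
      rw [key] at this
      simpa [htr0] using this
    · apply nondeg
      intro a
      have := hv a 0 0
      rw [key] at this
      simpa [htr0] using this
  · rintro ⟨h1, h2, h3⟩ a b c
    rw [key, h1, h2, h3]
    simp [htr0]

lemma cm_sum_supp (m : ℕ) (v : Option (GaloisField 3 m) → ZMod 3) {R : Type*} [Semiring R]
    (φ : ZMod 3 →+* R) (h : GaloisField 3 m → R) :
    ∑ x, φ (v (some x)) * h x
      = ∑ x ∈ Finset.univ.filter (fun x => v (some x) ≠ 0), φ (v (some x)) * h x := by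
  symm
  apply Finset.sum_subset (Finset.subset_univ _)
  intro x _ hx
  simp only [Finset.mem_filter, Finset.mem_univ, true_and, not_not] at hx
  rw [hx, map_zero, zero_mul]

lemma cm_hamming (m : ℕ) (v : Option (GaloisField 3 m) → ZMod 3) :
    hammingNorm v = (if v none ≠ 0 then 1 else 0)
      + (Finset.univ.filter (fun x => v (some x) ≠ 0)).card := by
  unfold hammingNorm
  rw [Finset.card_filter, Fintype.sum_option, Finset.card_filter]

lemma cm_card_field {m : ℕ} (hm : 0 < m) : Fintype.card (GaloisField 3 m) = 3 ^ m := by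
  rw [← Nat.card_eq_fintype_card]
  exact GaloisField.card 3 m hm.ne'

lemma cm_signs4 : ∀ a b c d : ZMod 3, a ≠ 0 → b ≠ 0 → c ≠ 0 → d ≠ 0 → a + (b + (c + d)) = 0 →
    (b = a ∧ c = -a ∧ d = -a) ∨ (c = a ∧ b = -a ∧ d = -a) ∨ (d = a ∧ b = -a ∧ c = -a) := by
  have h : ∀ x : ZMod 3, x ≠ 0 → x = 1 ∨ x = -1 := by decide
  intro a b c d ha hb hc hd
  rcases h a ha with rfl | rfl <;> rcases h b hb with rfl | rfl <;>
    rcases h c hc with rfl | rfl <;> rcases h d hd with rfl | rfl <;> decide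

lemma cm_signs3 : ∀ a b c : ZMod 3, a ≠ 0 → b ≠ 0 → c ≠ 0 → a + (b + c) = 0 → b = a ∧ c = a := by
  decide

lemma cm_struct {m k : ℕ} (hm : 0 < m) (hk : Odd k) (hmk : Nat.gcd m k = 1)
    (v : Option (GaloisField 3 m) → ZMod 3) (hv : v ∈ fullDual m k) (hw : hammingNorm v = 4) :
    v none ≠ 0 ∧ (Finset.univ.filter (fun x => v (some x) ≠ 0)).card = 3 := by
  have hF := cm_card_field hm
  rw [cm_hamming] at hw
  by_cases h0 : v none = 0
  · exfalso
    simp only [h0, ne_eq, not_true_eq_false, if_false, zero_add] at hw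
    obtain ⟨s1, s2, s3⟩ := (cm_mem_dual m k v).1 hv
    have s1' : ∑ x, (RingHom.id (ZMod 3)) (v (some x)) * (1 : ZMod 3) = 0 := by simpa using s1
    rw [cm_sum_supp m v (RingHom.id (ZMod 3)) (fun _ => 1)] at s1'
    rw [cm_sum_supp m v (algebraMap _ _) (fun x => x)] at s2
    rw [cm_sum_supp m v (algebraMap _ _) (cmf m k), h0] at s3
    have hmem : ∀ x, x ∈ Finset.univ.filter (fun x => v (some x) ≠ 0) → v (some x) ≠ 0 := by
      intro x hx; simpa using hx
    obtain ⟨a, D1, ha, hD1, hc1⟩ := Finset.card_eq_succ.1 hw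
    obtain ⟨b, c, d, hbc, hbd, hcd, hD2⟩ := Finset.card_eq_three.1 hc1
    subst hD2
    rw [← hD1] at s1' s2 s3 hmem
    simp only [Finset.mem_insert, Finset.mem_singleton, not_or] at ha
    obtain ⟨hab, hac, had⟩ := ha
    have na := hmem a (by simp)
    have nb := hmem b (by simp)
    have nc := hmem c (by simp)
    have nd := hmem d (by simp)
    have hsum : ∀ {R : Type} [CommRing R] (φ : ZMod 3 →+* R) (h : GaloisField 3 m → R),
        ∑ x ∈ insert a ({b, c, d} : Finset (GaloisField 3 m)), φ (v (some x)) * h x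
        = φ (v (some a)) * h a + (φ (v (some b)) * h b + (φ (v (some c)) * h c +
          φ (v (some d)) * h d)) := by
      intro R _ φ h
      rw [Finset.sum_insert (by simp [hab, hac, had]), Finset.sum_insert (by simp [hbc, hbd]),
        Finset.sum_pair hcd]
    rw [hsum] at s1' s2 s3
    simp only [RingHom.id_apply, mul_one] at s1'
    have hna : algebraMap (ZMod 3) (GaloisField 3 m) (v (some a)) ≠ 0 := by
      rw [map_ne_zero]; exact na
    rw [map_zero, add_zero] at s3
    rcases cm_signs4 _ _ _ _ na nb nc nd s1' with ⟨h1, h2, h3⟩ | ⟨h1, h2, h3⟩ | ⟨h1, h2, h3⟩ <;>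
      rw [h1, h2, h3, map_neg] at s2 s3
    · apply had
      apply cm_planar hF hk hmk a b c d hac
      · apply mul_left_cancel₀ hna; linear_combination s2
      · apply mul_left_cancel₀ hna; unfold cmf at s3; linear_combination s3
    · apply had
      apply cm_planar hF hk hmk a c b d hab
      · apply mul_left_cancel₀ hna; linear_combination s2
      · apply mul_left_cancel₀ hna; unfold cmf at s3; linear_combination s3
    · apply hac
      apply cm_planar hF hk hmk a d b c hab
      · apply mul_left_cancel₀ hna; linear_combination s2
      · apply mul_left_cancel₀ hna; unfold cmf at s3; linear_combination s3
  · refine ⟨h0, ?_⟩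
    rw [if_pos h0] at hw
    omega

/-- the sum of `f` over the line through `t` and `u` -/
def cmS (m k : ℕ) (t u : GaloisField 3 m) : GaloisField 3 m :=
  cmf m k t + cmf m k u + cmf m k (-t - u)

/-- the two dual codewords attached to a pair of points -/
def cmVec (m k : ℕ) (s : ZMod 3) (t t' : GaloisField 3 m) : Option (GaloisField 3 m) → ZMod 3 :=
  fun i => i.elim (if cmS m k t t' = 1 then -s else s)
    (fun x => if x = t ∨ x = t' ∨ x = -t - t' then s else 0)

lemma cm_third_ne {m : ℕ} {t t' : GaloisField 3 m} (h : t ≠ t') : t ≠ -t - t' ∧ t' ≠ -t - t' := by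
  have h3 : (3 : GaloisField 3 m) = 0 := cm_three
  constructor
  · intro e; apply h; linear_combination -e + t * h3
  · intro e; apply h; linear_combination e - t' * h3

lemma cm_struct2 {m k : ℕ} (hm : 0 < m) (hk : Odd k) (hmk : Nat.gcd m k = 1)
    (v : Option (GaloisField 3 m) → ZMod 3) (hv : v ∈ fullDual m k) (hw : hammingNorm v = 4)
    (t t' : GaloisField 3 m) (hne : t ≠ t') (ht : v (some t) ≠ 0) (ht' : v (some t') ≠ 0) :
    (cmS m k t t' = 1 ∨ cmS m k t t' = -1) ∧ v = cmVec m k (v (some t)) t t' := by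
  obtain ⟨h0, hc⟩ := cm_struct hm hk hmk v hv hw
  obtain ⟨s1, s2, s3⟩ := (cm_mem_dual m k v).1 hv
  have s1' : ∑ x, (RingHom.id (ZMod 3)) (v (some x)) * (1 : ZMod 3) = 0 := by simpa using s1
  rw [cm_sum_supp m v (RingHom.id (ZMod 3)) (fun _ => 1)] at s1'
  rw [cm_sum_supp m v (algebraMap _ _) (fun x => x)] at s2
  rw [cm_sum_supp m v (algebraMap _ _) (cmf m k)] at s3
  have hmem : ∀ x, x ∈ Finset.univ.filter (fun x => v (some x) ≠ 0) ↔ v (some x) ≠ 0 := by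
    intro x; simp
  generalize hD : Finset.univ.filter (fun x => v (some x) ≠ 0) = D at *
  have hz : ∃ z, z ≠ t ∧ z ≠ t' ∧ D = {t, t', z} := by
    have c1 : ((D.erase t).erase t').card = 1 := by
      rw [Finset.card_erase_of_mem, Finset.card_erase_of_mem, hc]
      · exact (hmem t).2 ht
      · exact Finset.mem_erase.2 ⟨hne.symm, (hmem t').2 ht'⟩
    obtain ⟨z, hz⟩ := Finset.card_eq_one.1 c1
    have hzm : z ∈ (D.erase t).erase t' := by rw [hz]; simp
    simp only [Finset.mem_erase] at hzm
    refine ⟨z, hzm.2.1, hzm.1, ?_⟩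
    rw [← hz, Finset.insert_erase, Finset.insert_erase]
    · exact (hmem t).2 ht
    · exact Finset.mem_erase.2 ⟨hne.symm, (hmem t').2 ht'⟩
  obtain ⟨z, hzt, hzt', hDz⟩ := hz
  have hsum : ∀ {R : Type} [CommRing R] (φ : ZMod 3 →+* R) (h : GaloisField 3 m → R),
      ∑ x ∈ D, φ (v (some x)) * h x
      = φ (v (some t)) * h t + (φ (v (some t')) * h t' + φ (v (some z)) * h z) := by
    intro R _ φ h
    rw [hDz, Finset.sum_insert (by simp [hne, hzt.symm]), Finset.sum_pair hzt'.symm]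
  rw [hsum] at s1' s2 s3
  simp only [RingHom.id_apply, mul_one] at s1'
  have hvz : v (some z) ≠ 0 := by rw [← hmem, hDz]; simp
  obtain ⟨e1, e2⟩ := cm_signs3 _ _ _ ht ht' hvz s1'
  rw [e1, e2] at s2 s3
  have hna : algebraMap (ZMod 3) (GaloisField 3 m) (v (some t)) ≠ 0 := by
    rw [map_ne_zero]; exact ht
  have hzeq : z = -t - t' := by
    apply mul_left_cancel₀ hna; linear_combination s2
  have hS : algebraMap (ZMod 3) (GaloisField 3 m) (v (some t)) * cmS m k t t'
      = - algebraMap (ZMod 3) (GaloisField 3 m) (v none) := by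
    unfold cmS; rw [← hzeq]; linear_combination s3
  have hcases : v none = v (some t) ∨ v none = - v (some t) := by
    revert h0 ht
    generalize v none = a
    generalize v (some t) = b
    revert a b
    decide
  have hsome : ∀ x, v (some x) = if x = t ∨ x = t' ∨ x = -t - t' then v (some t) else 0 := by
    intro x
    split_ifs with hx
    · rcases hx with rfl | rfl | hx
      · rfl
      · exact e1
      · rw [hx, ← hzeq, e2]
    · by_contra hxx
      rw [← ne_eq, ← hmem, hDz, hzeq] at hxx
      simp only [Finset.mem_insert, Finset.mem_singleton] at hxx
      exact hx hxx
  have hone : (-1 : GaloisField 3 m) ≠ 1 := by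
    have h3 : (3 : GaloisField 3 m) = 0 := cm_three
    intro h
    exact one_ne_zero (α := GaloisField 3 m) (by linear_combination h3 + h)
  rcases hcases with h | h
  · have hS1 : cmS m k t t' = -1 := by
      apply mul_left_cancel₀ hna; rw [hS, h]; ring
    refine ⟨Or.inr hS1, ?_⟩
    funext i
    cases i with
    | none => simp only [cmVec, Option.elim, hS1, hone, if_false, h]
    | some x => simp only [cmVec, Option.elim]; exact hsome x
  · have hS1 : cmS m k t t' = 1 := by
      apply mul_left_cancel₀ hna; rw [hS, h, map_neg]; ring
    refine ⟨Or.inl hS1, ?_⟩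
    funext i
    cases i with
    | none => simp only [cmVec, Option.elim, hS1, if_true, h]
    | some x => simp only [cmVec, Option.elim]; exact hsome x

lemma cm_vec_mem {m k : ℕ} (s : ZMod 3) (hs : s ≠ 0)
    (t t' : GaloisField 3 m) (hne : t ≠ t') (hS : cmS m k t t' = 1 ∨ cmS m k t t' = -1) :
    cmVec m k s t t' ∈ fullDual m k ∧ hammingNorm (cmVec m k s t t') = 4 := by
  have h3 : (3 : GaloisField 3 m) = 0 := cm_three
  have hone : (-1 : GaloisField 3 m) ≠ 1 := by
    intro h
    exact one_ne_zero (α := GaloisField 3 m) (by linear_combination h3 + h)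
  obtain ⟨hz1, hz2⟩ := cm_third_ne hne
  have hsupp : Finset.univ.filter (fun x => cmVec m k s t t' (some x) ≠ 0)
      = {t, t', -t - t'} := by
    ext x
    simp [cmVec, hs]
    tauto
  have hsum : ∀ {R : Type} [CommRing R] (φ : ZMod 3 →+* R) (h : GaloisField 3 m → R),
      ∑ x, φ (cmVec m k s t t' (some x)) * h x = φ s * (h t + h t' + h (-t - t')) := by
    intro R _ φ h
    rw [cm_sum_supp, hsupp, Finset.sum_insert (by simp [hne, hz1]), Finset.sum_pair hz2]
    simp only [cmVec, Option.elim, true_or, or_true, if_true]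
    ring
  constructor
  · rw [cm_mem_dual]
    refine ⟨?_, ?_, ?_⟩
    · have := hsum (RingHom.id (ZMod 3)) (fun _ => 1)
      simp only [RingHom.id_apply, mul_one] at this
      rw [this, show (1 + 1 + 1 : ZMod 3) = 0 by decide, mul_zero]
    · rw [hsum _ (fun x => x)]; ring
    · rw [hsum _ (cmf m k)]
      change _ * cmS m k t t' + _ = 0
      rcases hS with h | h
      · simp only [cmVec, Option.elim, h, if_true, map_neg]; ring
      · simp only [cmVec, Option.elim, h, hone, if_false]; ring
  · rw [cm_hamming, hsupp, Finset.card_eq_three.2 ⟨t, t', -t - t', hne, hz1, hz2, rfl⟩, if_pos]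
    simp only [cmVec, Option.elim]
    split_ifs
    · exact neg_ne_zero.2 hs
    · exact hs

lemma cm_count {m k : ℕ} (hm : 0 < m) (hk : Odd k) (hmk : Nat.gcd m k = 1) :
    dualA m k 4 * 6 = 3 ^ m * (if Even m then 4 else 2) * 2 := by
  rw [← cm_card_U (cm_card_field hm) hk hmk]
  unfold dualA
  rw [Nat.card_eq_fintype_card, Fintype.card_subtype]
  apply Finset.card_mul_eq_card_mul
    (fun (v : Option (GaloisField 3 m) → ZMod 3) (p : GaloisField 3 m × GaloisField 3 m) =>
      v (some p.1) ≠ 0 ∧ v (some p.2) ≠ 0)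
  · intro v hv
    simp only [Finset.mem_filter, Finset.mem_univ, true_and] at hv
    obtain ⟨hv, hw⟩ := hv
    obtain ⟨h0, hc⟩ := cm_struct hm hk hmk v hv hw
    have : (Finset.univ.filter (fun x => v (some x) ≠ 0)).offDiag.card = 6 := by
      rw [Finset.offDiag_card, hc]
    rw [← this]
    congr 1
    ext ⟨t, t'⟩
    simp only [Finset.mem_bipartiteAbove, Finset.mem_filter, Finset.mem_univ, true_and,
      Finset.mem_offDiag]
    constructor
    · rintro ⟨⟨h1, h2⟩, h3, h4⟩
      exact ⟨h3, h4, h1⟩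
    · rintro ⟨h3, h4, h1⟩
      exact ⟨⟨h1, (cm_struct2 hm hk hmk v hv hw t t' h1 h3 h4).1⟩, h3, h4⟩
  · rintro ⟨t, t'⟩ hp
    simp only [Finset.mem_filter, Finset.mem_univ, true_and] at hp
    obtain ⟨hne, hS⟩ := hp
    have hS' : cmS m k t t' = 1 ∨ cmS m k t t' = -1 := hS
    rw [Finset.card_eq_two]
    refine ⟨cmVec m k 1 t t', cmVec m k (-1) t t', ?_, ?_⟩
    · intro h
      have := congrFun h (some t)
      simp only [cmVec, Option.elim, true_or, if_true] at this
      exact absurd this (by decide)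
    · ext v
      simp only [Finset.mem_bipartiteBelow, Finset.mem_filter, Finset.mem_univ, true_and,
        Finset.mem_insert, Finset.mem_singleton]
      constructor
      · rintro ⟨⟨hv, hw⟩, h1, h2⟩
        have hveq := (cm_struct2 hm hk hmk v hv hw t t' hne h1 h2).2
        have : v (some t) = 1 ∨ v (some t) = -1 := by
          revert h1
          generalize v (some t) = a
          revert a
          decide
        rcases this with h | h
        · left; rwa [h] at hveq
        · right; rwa [h] at hveq
      · have aux : ∀ s : ZMod 3, s ≠ 0 → v = cmVec m k s t t' →
            (v ∈ fullDual m k ∧ hammingNorm v = 4) ∧ v (some t) ≠ 0 ∧ v (some t') ≠ 0 := by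
          rintro s hs rfl
          exact ⟨cm_vec_mem s hs t t' hne hS', by simpa [cmVec] using hs, by simpa [cmVec] using hs⟩
        rintro (h | h)
        · exact aux 1 (by decide) h
        · exact aux (-1) (by decide) h

/-- For `k` odd with `gcd(m,k) = 1` and the Coulter–Matthews
function `f(x) = x^{(3^k+1)/2}` on `F_{3^m}`, the dual `C_f^⊥` of the subfield code
has `A_4^⊥ = 4·3^{m−1}` if `m` is even, and `A_4^⊥ = 2·3^{m−1}` if `m` is odd. -/
theorem stmt_14 (m k : ℕ) (hm : 0 < m) (hk : Odd k) (hmk : Nat.gcd m k = 1) :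
    (Even m → dualA m k 4 = 4 * 3 ^ (m - 1)) ∧
    (Odd m → dualA m k 4 = 2 * 3 ^ (m - 1)) := by
  have h := cm_count hm hk hmk
  obtain ⟨r, rfl⟩ : ∃ r, m = r + 1 := ⟨m - 1, by omega⟩
  rw [Nat.add_sub_cancel]
  rw [pow_succ] at h
  constructor
  · intro he
    rw [if_pos he] at h
    omega
  · intro ho
    rw [if_neg (Nat.not_even_iff_odd.2 ho)] at h
    omega
end
end

section
/- Let m and k be positive integers with k odd and gcd(m,k) = 1, and let f(x) = x^{(3^k+1)/2} on F_{3^m}. Then the dual code C_f^⊥ of the subfield code C_f ⊆ F_3^{3^m+1} has dimension 3^m − 2m over F_3 and minimum Hamming distance exactly 4; that is, C_f^⊥ is a ternary [3^m+1, 3^m−2m, 4] code. -/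
noncomputable section
open scoped Classical

theorem fin3_aux : ∀ a b c : Fin 3, a ≠ 0 → b ≠ 0 → c ≠ 0 → a + b + c = 0 → a = b ∧ c = b := by
  decide

theorem zmod3_aux : ∀ a b c : ZMod 3, a ≠ 0 → b ≠ 0 → c ≠ 0 → a + b + c = 0 → a = b ∧ c = b :=
  fin3_aux

theorem cm_coprime (m k e : ℕ) (hk : Odd k) (hmk : Nat.gcd m k = 1)
    (he : 3 ^ k = 2 * e + 1) : Nat.Coprime e (3 ^ (2 * m) - 1) := by
  have h1 : Nat.gcd (3 ^ k - 1) (3 ^ (2 * m) - 1) = 2 := by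
    rw [Nat.pow_sub_one_gcd_pow_sub_one]
    have : Nat.gcd k (2 * m) = 1 := by
      have a : Nat.Coprime k 2 := Nat.coprime_two_right.2 hk
      have b : Nat.Coprime k m := Nat.Coprime.symm hmk
      exact Nat.Coprime.mul_right a b
    rw [this]
    norm_num
  have h2 : Odd e := by
    obtain ⟨j, rfl⟩ := hk
    have h9 : (3 : ℕ) ^ (2 * j + 1) % 4 = 3 := by
      rw [pow_succ, pow_mul, Nat.mul_mod, Nat.pow_mod]
      norm_num
    rw [he] at h9
    rw [Nat.odd_iff]
    omega
  have h3 : Nat.gcd e (3 ^ (2 * m) - 1) ∣ 2 := by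
    refine Nat.dvd_trans (Nat.dvd_gcd (m := 3 ^ k - 1) (n := 3 ^ (2 * m) - 1) ?_ ?_) h1.dvd
    · exact (Nat.gcd_dvd_left _ _).trans ⟨2, by omega⟩
    · exact Nat.gcd_dvd_right _ _
  have h4 : Odd (Nat.gcd e (3 ^ (2 * m) - 1)) := Odd.of_dvd_nat h2 (Nat.gcd_dvd_left _ _)
  rcases (Nat.dvd_prime Nat.prime_two).1 h3 with h | h
  · exact h
  · rw [h] at h4
    exact absurd h4 (by decide)

theorem pow_inj_coprime {K : Type*} [Field K] {e N : ℕ} (h : Nat.Coprime e N) {y z : K}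
    (hz : z ≠ 0) (hyN : y ^ N = 1) (hzN : z ^ N = 1) (he : y ^ e = z ^ e) : y = z := by
  have h1 : (y / z) ^ e = 1 := by
    rw [div_pow, he, div_self (pow_ne_zero _ hz)]
  have h2 : (y / z) ^ N = 1 := by
    rw [div_pow, hyN, hzN, div_one]
  have h3 : orderOf (y / z) ∣ 1 := by
    rw [← Nat.Coprime.gcd_eq_one h]
    exact Nat.dvd_gcd (orderOf_dvd_of_pow_eq_one h1) (orderOf_dvd_of_pow_eq_one h2)
  have h4 : y / z = 1 := orderOf_eq_one_iff.1 (Nat.dvd_one.1 h3)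
  exact (div_eq_one_iff_eq hz).1 h4

theorem step_identity {K : Type*} [Field K] [CharP K 3] {k d e : ℕ} (he : 3 ^ k = 2 * e + 1)
    (hd : d = e + 1) (s t : K) (hst : s * t = 1) :
    (s ^ 2 + t ^ 2 + 1) ^ d - (s ^ 2 + t ^ 2 - 1) ^ d = - 2 * -((s ^ 2) ^ e + (t ^ 2) ^ e) * (-1) := by
  have h3 : (3 : K) = 0 := by exact_mod_cast CharP.cast_eq_zero K 3
  have e1 : s ^ 2 + t ^ 2 + 1 = (s - t) ^ 2 := by linear_combination (2 : K) * hst + h3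
  have e2 : s ^ 2 + t ^ 2 - 1 = (s + t) ^ 2 := by linear_combination (-2 : K) * hst - h3
  have h2d : 2 * d = 3 ^ k + 1 := by omega
  have p1 : s ^ (3 ^ k) = (s ^ 2) ^ e * s := by rw [he, pow_succ, pow_mul]
  have p2 : t ^ (3 ^ k) = (t ^ 2) ^ e * t := by rw [he, pow_succ, pow_mul]
  rw [e1, e2, ← pow_mul, ← pow_mul, h2d, pow_succ, pow_succ, sub_pow_char_pow, add_pow_char_pow,
    p1, p2]
  linear_combination (-2 * ((s ^ 2) ^ e + (t ^ 2) ^ e)) * hst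

theorem exists_param {F K : Type*} [Field F] [Fintype F] [Field K] [IsAlgClosed K] [Algebra F K]
    [CharP K 3] (m : ℕ) (hF : Fintype.card F = 3 ^ m) (x : F) :
    ∃ s t : K, s * t = 1 ∧ algebraMap F K x = s ^ 2 + t ^ 2 ∧ (s ^ 2) ^ (3 ^ (2 * m) - 1) = 1 := by
  set X := algebraMap F K x with hX
  have hXQ : X ^ 3 ^ m = X := by
    rw [hX, ← map_pow, ← hF, FiniteField.pow_card]
  have hroot : ∃ y : K, y ^ 2 - X * y + 1 = 0 := by
    have := IsAlgClosed.exists_root (Polynomial.C 1 * Polynomial.X ^ 2 + Polynomial.C (-X) * Polynomial.X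
      + Polynomial.C (1 : K)) (by
        rw [Polynomial.degree_quadratic one_ne_zero]; decide)
    obtain ⟨y, hy⟩ := this
    refine ⟨y, ?_⟩
    simp [Polynomial.IsRoot] at hy
    linear_combination hy
  obtain ⟨y, hy⟩ := hroot
  have hy0 : y ≠ 0 := by
    rintro rfl
    simp at hy
  obtain ⟨s, hs⟩ := IsAlgClosed.exists_pow_nat_eq y (n := 2) (by norm_num)
  have hs0 : s ≠ 0 := by
    rintro rfl
    apply hy0
    rw [← hs]
    simp
  have hst : s * s⁻¹ = 1 := mul_inv_cancel₀ hs0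
  refine ⟨s, s⁻¹, hst, ?_, ?_⟩
  · have : y * (X - (s ^ 2 + s⁻¹ ^ 2)) = 0 := by
      rw [← hs] at hy ⊢
      linear_combination -hy - (s * s⁻¹ + 1) * hst
    rcases mul_eq_zero.1 this with h | h
    · exact absurd h hy0
    · exact sub_eq_zero.1 h
  · rw [hs]
    have hq : (y ^ 3 ^ m) ^ 2 - X * y ^ 3 ^ m + 1 = 0 := by
      have := congrArg (fun z => z ^ 3 ^ m) hy
      simp only [add_pow_char_pow, sub_pow_char_pow, mul_pow, hXQ, one_pow] at this
      rw [zero_pow (by positivity)] at this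
      rw [← this]
      ring
    have hcase : (y ^ 3 ^ m - y) * (y ^ 3 ^ m * y - 1) = 0 := by
      linear_combination y * hq - y ^ 3 ^ m * hy
    have hyy : y ^ 3 ^ (2 * m) = y := by
      have e1 : y ^ 3 ^ (2 * m) = (y ^ 3 ^ m) ^ 3 ^ m := by
        rw [← pow_mul, ← pow_add, two_mul]
      rw [e1]
      rcases mul_eq_zero.1 hcase with h | h
      · have h := sub_eq_zero.1 h
        rw [h, h]
      · have h := eq_inv_of_mul_eq_one_left (sub_eq_zero.1 h)
        rw [h, inv_pow, h, inv_inv]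
    have hpos : 0 < 3 ^ (2 * m) := by positivity
    have : y ^ (3 ^ (2 * m) - 1) * y = 1 * y := by
      rw [← pow_succ, Nat.sub_add_cancel hpos, hyy, one_mul]
    exact mul_right_cancel₀ hy0 this

theorem planar_one {F : Type*} [Field F] [Fintype F] [CharP F 3] (m k d : ℕ)
    (hF : Fintype.card F = 3 ^ m) (hk : Odd k) (hmk : Nat.gcd m k = 1) (hd : 2 * d = 3 ^ k + 1)
    (x y : F) (h : (x + 1) ^ d - (x - 1) ^ d = (y + 1) ^ d - (y - 1) ^ d) : x = y := by
  have : CharP (AlgebraicClosure F) 3 := charP_of_injective_algebraMap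
    (algebraMap F (AlgebraicClosure F)).injective 3
  obtain ⟨e, rfl⟩ : ∃ e, d = e + 1 := ⟨d - 1, by
    have : 0 < 3 ^ k := by positivity
    omega⟩
  have he : 3 ^ k = 2 * e + 1 := by omega
  have hc := cm_coprime m k e hk hmk he
  obtain ⟨s, t, hst, hx, hsN⟩ := exists_param (K := AlgebraicClosure F) m hF x
  obtain ⟨s', t', hst', hy, hsN'⟩ := exists_param (K := AlgebraicClosure F) m hF y
  have h' := congrArg (algebraMap F (AlgebraicClosure F)) h
  simp only [map_sub, map_pow, map_add, map_one, hx, hy] at h'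
  rw [step_identity he rfl s t hst, step_identity he rfl s' t' hst'] at h'
  have h3 : (3 : AlgebraicClosure F) = 0 := by exact_mod_cast CharP.cast_eq_zero _ 3
  have h2 : (2 : AlgebraicClosure F) = -1 := by linear_combination h3
  rw [h2] at h'
  have hAB : (s ^ 2) ^ e * (t ^ 2) ^ e = 1 := by
    rw [← mul_pow, ← mul_pow, hst]; simp
  have hAB' : (s' ^ 2) ^ e * (t' ^ 2) ^ e = 1 := by
    rw [← mul_pow, ← mul_pow, hst']; simp
  have hst2 : s ^ 2 * t ^ 2 = 1 := by rw [← mul_pow, hst, one_pow]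
  have hst2' : s' ^ 2 * t' ^ 2 = 1 := by rw [← mul_pow, hst', one_pow]
  have htN' : (t' ^ 2) ^ (3 ^ (2 * m) - 1) = 1 := by
    have : (s' ^ 2) ^ (3 ^ (2 * m) - 1) * (t' ^ 2) ^ (3 ^ (2 * m) - 1) = 1 := by
      rw [← mul_pow, hst2', one_pow]
    rwa [hsN', one_mul] at this
  have hs0' : s' ^ 2 ≠ 0 := left_ne_zero_of_mul_eq_one hst2'
  have ht0' : t' ^ 2 ≠ 0 := right_ne_zero_of_mul_eq_one hst2'
  apply (algebraMap F (AlgebraicClosure F)).injective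
  rw [hx, hy]
  have hprod : ((s ^ 2) ^ e - (s' ^ 2) ^ e) * ((s ^ 2) ^ e - (t' ^ 2) ^ e) = 0 := by
    linear_combination (s ^ 2) ^ e * h' + hAB' - hAB
  rcases mul_eq_zero.1 hprod with h | h
  · have := pow_inj_coprime hc hs0' hsN hsN' (sub_eq_zero.1 h)
    rw [this] at hst2 ⊢
    have : t ^ 2 = t' ^ 2 := mul_left_cancel₀ hs0' (hst2.trans hst2'.symm)
    rw [this]
  · have := pow_inj_coprime hc ht0' hsN htN' (sub_eq_zero.1 h)
    rw [this] at hst2 ⊢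
    have : t ^ 2 = s' ^ 2 := mul_left_cancel₀ ht0' (hst2.trans (by rw [mul_comm, hst2']))
    rw [this, add_comm]

theorem planar {F : Type*} [Field F] [Fintype F] [CharP F 3] (m k d : ℕ)
    (hF : Fintype.card F = 3 ^ m) (hk : Odd k) (hmk : Nat.gcd m k = 1) (hd : 2 * d = 3 ^ k + 1)
    (u x y : F) (hu : u ≠ 0) (h : (x + u) ^ d - x ^ d = (y + u) ^ d - y ^ d) : x = y := by
  have h3 : (3 : F) = 0 := by exact_mod_cast CharP.cast_eq_zero _ 3
  have a1 : ∀ x : F, x = u * ((x / u - 1) + 1) := fun x => by field_simp; ring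
  have a2 : ∀ x : F, x + u = u * ((x / u - 1) - 1) := fun x => by
    field_simp; linear_combination u * h3
  rw [a2 x, a2 y] at h
  nth_rewrite 2 [a1 x] at h
  nth_rewrite 2 [a1 y] at h
  simp only [mul_pow] at h
  have hud : u ^ d ≠ 0 := pow_ne_zero _ hu
  have := planar_one m k d hF hk hmk hd (x / u - 1) (y / u - 1)
    (mul_left_cancel₀ hud (by linear_combination -h))
  have := sub_left_injective this
  exact (div_left_inj' hu).1 this

theorem card_gf (m : ℕ) (hm : 0 < m) : Fintype.card (GaloisField 3 m) = 3 ^ m := by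
  rw [← Nat.card_eq_fintype_card]
  exact GaloisField.card 3 m hm.ne'

theorem cm_two_mul (k : ℕ) : 2 * ((3 ^ k + 1) / 2) = 3 ^ k + 1 := by
  have : (3 : ℕ) ^ k % 2 = 1 := by rw [Nat.pow_mod]; norm_num
  omega

theorem cmf_planar (m k : ℕ) (hm : 0 < m) (hk : Odd k) (hmk : Nat.gcd m k = 1)
    (u x y : GaloisField 3 m) (hu : u ≠ 0)
    (h : cmf m k (x + u) - cmf m k x = cmf m k (y + u) - cmf m k y) : x = y :=
  planar m k _ (card_gf m hm) hk hmk (cm_two_mul k) u x y hu h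

theorem tr_nondeg (m : ℕ) (z : GaloisField 3 m) (h : ∀ a, tr m (a * z) = 0) : z = 0 := by
  have := (traceForm_nondegenerate (ZMod 3) (GaloisField 3 m))
  apply this.2 z
  intro a
  exact h a

theorem cmf_zero (m k : ℕ) : cmf m k 0 = 0 := by
  unfold cmf
  apply zero_pow
  have := cm_two_mul k
  have : 0 < 3 ^ k := by positivity
  omega

def encL (m k : ℕ) : (GaloisField 3 m × GaloisField 3 m × ZMod 3) →ₗ[ZMod 3]
    (Option (GaloisField 3 m) → ZMod 3) where
  toFun p := fullWord m k p.1 p.2.1 p.2.2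
  map_add' p q := by
    funext i
    cases i <;> simp [fullWord, tr, add_mul] <;> ring
  map_smul' r p := by
    funext i
    cases i <;> simp [fullWord, tr, mul_add]

theorem encL_inj (m k : ℕ) (hm : 0 < m) (hk : Odd k) (hmk : Nat.gcd m k = 1) :
    Function.Injective (encL m k) := by
  rw [← LinearMap.ker_eq_bot, LinearMap.ker_eq_bot']
  rintro ⟨a, b, c⟩ h
  have hx : ∀ x, tr m (a * cmf m k x + b * x) + c = 0 := fun x => congrFun h (some x)
  have hc : c = 0 := by
    have := hx 0
    simpa [cmf_zero, tr] using this
  subst hc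
  simp only [add_zero] at hx
  have ha : a = 0 := by
    let D : GaloisField 3 m → GaloisField 3 m := fun x => cmf m k (x + 1) - cmf m k x
    have hD : Function.Injective D := fun x y hxy =>
      cmf_planar m k hm hk hmk 1 x y one_ne_zero hxy
    have hS : Function.Surjective D := Finite.surjective_of_injective hD
    have hconst : ∀ x, tr m (a * D x) = - tr m b := by
      intro x
      have h1 := hx (x + 1)
      have h2 := hx x
      simp only [tr, D, mul_sub, mul_add, map_sub, map_add, mul_one] at h1 h2 ⊢
      linear_combination h1 - h2
    have hb : tr m b = 0 := by
      obtain ⟨x, hx0⟩ := hS 0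
      have := hconst x
      rw [hx0] at this
      simpa [tr] using this
    apply tr_nondeg
    intro z
    obtain ⟨x, rfl⟩ := hS z
    rw [mul_comm, hconst, hb, neg_zero]
  subst ha
  have hb : b = 0 := by
    apply tr_nondeg
    intro z
    have := hx z
    rwa [zero_mul, zero_add, mul_comm] at this
  subst hb
  rfl

theorem mem_dual (m k : ℕ) (v : Option (GaloisField 3 m) → ZMod 3) :
    v ∈ fullDual m k ↔ (algebraMap (ZMod 3) (GaloisField 3 m) (v none) +
        ∑ x, v (some x) • cmf m k x = 0 ∧ ∑ x, v (some x) • x = 0 ∧ ∑ x, v (some x) = 0) := by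
  have key : ∀ a b c, ∑ i, v i * fullWord m k a b c i =
      tr m (a * (algebraMap (ZMod 3) (GaloisField 3 m) (v none) + ∑ x, v (some x) • cmf m k x))
      + tr m (b * ∑ x, v (some x) • x) + c * ∑ x, v (some x) := by
    intro a b c
    rw [Fintype.sum_option]
    have e0 : tr m (a * algebraMap (ZMod 3) (GaloisField 3 m) (v none)) = v none * tr m a := by
      rw [mul_comm, ← Algebra.smul_def]
      simp [tr]
    have e1 : ∀ g : GaloisField 3 m → GaloisField 3 m, ∀ a, tr m (a * ∑ x, v (some x) • g x) =
        ∑ x, v (some x) * tr m (a * g x) := by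
      intro g a
      simp [tr, Finset.mul_sum]
    have e2 : ∀ y z, tr m (y + z) = tr m y + tr m z := fun y z => by simp [tr]
    rw [mul_add, e2, e0, e1, e1 (fun x => x), Finset.mul_sum, add_assoc, add_assoc,
      ← Finset.sum_add_distrib, ← Finset.sum_add_distrib]
    congr 1
    apply Finset.sum_congr rfl
    intro x _
    simp only [fullWord, Option.elim, e2]
    ring
  constructor
  · intro h
    have t0 : tr m 0 = 0 := by simp [tr]
    refine ⟨tr_nondeg m _ fun a => ?_, tr_nondeg m _ fun b => ?_, ?_⟩
    · have := h a 0 0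
      rw [key] at this
      simpa [t0] using this
    · have := h 0 b 0
      rw [key] at this
      simpa [t0] using this
    · have := h 0 0 1
      rw [key] at this
      simpa [t0] using this
  · rintro ⟨h1, h2, h3⟩ a b c
    rw [key, h1, h2, h3]
    simp [tr]

theorem dual_card (m k : ℕ) (hm : 0 < m) (hk : Odd k) (hmk : Nat.gcd m k = 1) :
    Set.ncard (fullDual m k) = 3 ^ (3 ^ m - 2 * m) := by
  let W : Submodule (ZMod 3) (Option (GaloisField 3 m) → ZMod 3) := LinearMap.range (encL m k)
  let B : LinearMap.BilinForm (ZMod 3) (Option (GaloisField 3 m) → ZMod 3) :=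
    dotProductBilin (ZMod 3) (ZMod 3)
  have hB : B.Nondegenerate := by
    constructor
    · intro x h
      exact dotProduct_eq_zero x h
    · intro x h
      refine dotProduct_eq_zero x fun w => ?_
      rw [dotProduct_comm]
      exact h w
  have hdual : fullDual m k = (B.orthogonal W : Set _) := by
    ext v
    constructor
    · rintro h _ ⟨⟨a, b, c⟩, rfl⟩
      have := h a b c
      change (fullWord m k a b c) ⬝ᵥ v = 0
      rw [dotProduct_comm]
      exact this
    · intro h a b c
      have : (fullWord m k a b c) ⬝ᵥ v = 0 := h _ ⟨⟨a, b, c⟩, rfl⟩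
      rw [dotProduct_comm] at this
      exact this
  have hW : Module.finrank (ZMod 3) W = 2 * m + 1 := by
    rw [LinearMap.finrank_range_of_inj (encL_inj m k hm hk hmk)]
    simp [GaloisField.finrank 3 hm.ne']
    ring
  have hfr := LinearMap.BilinForm.finrank_orthogonal hB W
  have hV : Module.finrank (ZMod 3) (Option (GaloisField 3 m) → ZMod 3) = 3 ^ m + 1 := by
    rw [Module.finrank_fintype_fun_eq_card, Fintype.card_option, card_gf m hm]
  rw [hW, hV] at hfr
  rw [hdual, ← Nat.card_coe_set_eq]
  have := Module.natCard_eq_pow_finrank (K := ZMod 3) (V := B.orthogonal W)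
  rw [Nat.card_zmod, hfr] at this
  rw [Nat.add_sub_add_right] at this
  exact this

theorem norm_split {α : Type*} [Fintype α] (v : Option α → ZMod 3) : hammingNorm v =
    (if v none ≠ 0 then 1 else 0) + (Finset.univ.filter fun x => v (some x) ≠ 0).card := by
  have : hammingNorm v = (Finset.univ.filter fun i => v i ≠ 0).card := by
    unfold hammingNorm
    congr
  rw [this, Finset.card_filter, Fintype.sum_option, Finset.card_filter]

theorem dual_min (m k : ℕ) (hm : 0 < m) (hk : Odd k) (hmk : Nat.gcd m k = 1)
    (v : Option (GaloisField 3 m) → ZMod 3) (hv : v ∈ fullDual m k) (hv0 : v ≠ 0) :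
    4 ≤ hammingNorm v := by
  obtain ⟨h1, h2, h3⟩ := (mem_dual m k v).1 hv
  let S : Finset (GaloisField 3 m) := Finset.univ.filter fun x => v (some x) ≠ 0
  have hsum : ∀ {M : Type} [AddCommMonoid M] [Module (ZMod 3) M] (g : GaloisField 3 m → M),
      ∑ x, v (some x) • g x = ∑ x ∈ S, v (some x) • g x := by
    intro M _ _ g
    symm
    apply Finset.sum_subset (Finset.subset_univ _)
    intro x _ hx
    have : v (some x) = 0 := by simpa [S] using hx
    rw [this, zero_smul]
  have hmem : ∀ x ∈ S, v (some x) ≠ 0 := fun x hx => (Finset.mem_filter.1 hx).2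
  have hnorm : hammingNorm v = (if v none ≠ 0 then 1 else 0) + S.card := norm_split v
  have h3' : ∑ x ∈ S, v (some x) = 0 := by
    have := hsum (fun _ => (1 : ZMod 3))
    simp only [smul_eq_mul, mul_one] at this
    rw [← this, h3]
  rw [hsum] at h1 h2
  by_contra hlt
  push Not at hlt
  have hS3 : S.card ≤ 3 := by omega
  have hz : ∀ a b c : ZMod 3, a ≠ 0 → b ≠ 0 → c ≠ 0 → a + b + c = 0 → a = b ∧ c = b := zmod3_aux
  interval_cases hS : S.card
  · have hS := Finset.card_eq_zero.1 hS
    rw [hS, Finset.sum_empty, add_zero] at h1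
    have hn : v none = 0 := by
      apply (algebraMap (ZMod 3) (GaloisField 3 m)).injective
      rw [h1, map_zero]
    apply hv0
    funext i
    cases i with
    | none => exact hn
    | some x =>
      by_contra hx
      have : x ∈ S := Finset.mem_filter.2 ⟨Finset.mem_univ _, hx⟩
      rw [hS] at this
      simp at this
  · obtain ⟨x, hS⟩ := Finset.card_eq_one.1 hS
    rw [hS, Finset.sum_singleton] at h3'
    exact hmem x (by simp [hS]) h3'
  · obtain ⟨x, y, hxy, hS⟩ := Finset.card_eq_two.1 hS
    rw [hS, Finset.sum_pair hxy] at h3' h2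
    have hvx := hmem x (by simp [hS])
    rw [eq_neg_of_add_eq_zero_right h3', neg_smul, ← sub_eq_add_neg, ← smul_sub] at h2
    rcases smul_eq_zero.1 h2 with h | h
    · exact hvx h
    · exact hxy (sub_eq_zero.1 h)
  · obtain ⟨x, y, z, hxy, hxz, hyz, hS⟩ := Finset.card_eq_three.1 hS
    have hn : v none = 0 := by
      by_contra hn
      rw [if_pos hn] at hnorm
      omega
    have hs3 : ∀ {M : Type} [AddCommMonoid M] (g : GaloisField 3 m → M),
        ∑ x ∈ S, g x = g x + g y + g z := by
      intro M _ g
      rw [hS, Finset.sum_insert (by simp [hxy, hxz]), Finset.sum_pair hyz, add_assoc]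
    rw [hs3] at h1 h2 h3'
    have hvy := hmem y (by simp [hS])
    obtain ⟨e1, e2⟩ := hz _ _ _ (hmem x (by simp [hS])) hvy
      (hmem z (by simp [hS])) h3'
    rw [e1, e2, ← smul_add, ← smul_add] at h1 h2
    rw [hn, map_zero, zero_add] at h1
    have h1 := (smul_eq_zero.1 h1).resolve_left hvy
    have h2 := (smul_eq_zero.1 h2).resolve_left hvy
    have c3 : (3 : GaloisField 3 m) = 0 := by exact_mod_cast CharP.cast_eq_zero _ 3
    -- x = y + u, z = y - u
    apply hyz
    apply cmf_planar m k hm hk hmk (x - y) y z (sub_ne_zero.2 hxy)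
    have r1 : y + (x - y) = x := by ring
    have r2 : z + (x - y) = y := by linear_combination h2 - y * c3
    rw [r1, r2]
    linear_combination h1 - cmf m k y * c3

theorem dual_exists (m k : ℕ) (hk : Odd k) :
    ∃ v ∈ fullDual m k, hammingNorm v = 4 := by
  have c3 : (3 : GaloisField 3 m) = 0 := by exact_mod_cast CharP.cast_eq_zero _ 3
  have h11 : (1 : GaloisField 3 m) ≠ -1 := by
    intro h
    apply one_ne_zero (α := GaloisField 3 m)
    linear_combination c3 - h
  let T : Finset (GaloisField 3 m) := {0, 1, -1}
  have hT : T.card = 3 := by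
    apply Finset.card_eq_three.2
    exact ⟨0, 1, -1, by simp, by simp, h11, rfl⟩
  have hsT : ∀ {M : Type} [AddCommMonoid M] (g : GaloisField 3 m → M),
      ∑ x ∈ T, g x = g 0 + g 1 + g (-1) := by
    intro M _ g
    rw [Finset.sum_insert (by simp), Finset.sum_pair h11, add_assoc]
  let v : Option (GaloisField 3 m) → ZMod 3 := fun i => i.elim 1 fun x => if x ∈ T then 1 else 0
  have heven : Even ((3 ^ k + 1) / 2) := by
    obtain ⟨j, rfl⟩ := hk
    have h9 : (3 : ℕ) ^ (2 * j + 1) % 4 = 3 := by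
      rw [pow_succ, pow_mul, Nat.mul_mod, Nat.pow_mod]
      norm_num
    rw [Nat.even_iff]
    generalize 3 ^ (2 * j + 1) = q at *
    omega
  refine ⟨v, (mem_dual m k v).2 ⟨?_, ?_, ?_⟩, ?_⟩
  · simp only [v, Option.elim, ite_smul, one_smul, zero_smul, Finset.sum_ite_mem, Finset.univ_inter]
    rw [hsT, cmf_zero]
    simp only [cmf, heven.neg_pow, one_pow, map_one]
    linear_combination c3
  · simp only [v, Option.elim, ite_smul, one_smul, zero_smul, Finset.sum_ite_mem, Finset.univ_inter]
    rw [hsT]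
    ring
  · simp only [v, Option.elim, Finset.sum_ite_mem, Finset.univ_inter]
    rw [hsT]
    decide
  · rw [norm_split]
    have : (Finset.univ.filter fun x => v (some x) ≠ 0) = T := by
      ext x
      simp [v]
    rw [this, hT]
    simp [v]

/-- For `k` odd with `gcd(m,k) = 1` and the Coulter–Matthews
function `f(x) = x^{(3^k+1)/2}` on `F_{3^m}`, the dual `C_f^⊥` of the subfield code is a
ternary `[3^m+1, 3^m−2m, 4]` code: it has `3^(3^m−2m)` elements (dimension `3^m − 2m`)
and minimum Hamming distance exactly `4`. -/
theorem stmt_17 (m k : ℕ) (hm : 0 < m) (hk : Odd k) (hmk : Nat.gcd m k = 1) :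
    Set.ncard (fullDual m k) = 3 ^ (3 ^ m - 2 * m) ∧
    (∀ v ∈ fullDual m k, v ≠ 0 → 4 ≤ hammingNorm v) ∧
    (∃ v ∈ fullDual m k, hammingNorm v = 4) := by
  exact ⟨dual_card m k hm hk hmk, dual_min m k hm hk hmk, dual_exists m k hk⟩
end
end
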